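/- arXiv:1005.3256 — 2 statements merged into one kernel-verified Lean document; each statement's English description precedes it below -/
import Mathlib

section
/- (Maximal degree.) For all N ≥ 0, the maximum of the coordinate a over the support of μ_{N,0} equals A^{m,n}_{N,0} = ⌈N/2⌉·m + (m+n)·(⌈N/2⌉ − 1)·⌈N/2⌉, and the maximum of a over the support of μ_{N,1} equals A^{m,n}_{N,1} = ⌊N/2⌋·(m+2n) + (m+n)·(⌊N/2⌋ − 1)·⌊N/2⌋. -/
open Finsupp Filter

noncomputable section

/-- Signed-sum convention: `signedSum c k = Σ_{i=0}^{k} c i`, which is the ordinary sum for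
`k ≥ 0`, is `0` for `k = -1`, and equals `-(c (-1) + c (-2) + ⋯ + c (k+1))` for `k ≤ -2`. -/
def signedSum {M : Type*} [AddCommGroup M] (c : ℤ → M) (k : ℤ) : M :=
  (∑ i ∈ Finset.range (k + 1).toNat, c i) -
    ∑ i ∈ Finset.range (-(k + 1)).toNat, c (-((i : ℤ) + 1))

/-- The Demazure operator `D₀` (relative to `Λ = mΛ₀ + nΛ₁`):
`D₀ δ_{(a,b)} = Σ_{i=0}^{m - 2(a-b)} δ_{(a+i,b)}`, extended ℤ-linearly. -/
def D0 (m : ℕ) (μ : ℤ × ℤ →₀ ℤ) : ℤ × ℤ →₀ ℤ :=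
  μ.sum fun p c =>
    c • signedSum (fun i => Finsupp.single (p.1 + i, p.2) (1 : ℤ)) ((m : ℤ) - 2 * (p.1 - p.2))

/-- The Demazure operator `D₁` (relative to `Λ = mΛ₀ + nΛ₁`):
`D₁ δ_{(a,b)} = Σ_{i=0}^{n + 2(a-b)} δ_{(a,b+i)}`, extended ℤ-linearly. -/
def D1 (n : ℕ) (μ : ℤ × ℤ →₀ ℤ) : ℤ × ℤ →₀ ℤ :=
  μ.sum fun p c =>
    c • signedSum (fun i => Finsupp.single (p.1, p.2 + i) (1 : ℤ)) ((n : ℤ) + 2 * (p.1 - p.2))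

/-- Total mass `μ(Γ)` of a finitely supported function on `ℤ × ℤ`. -/
def mass (μ : ℤ × ℤ →₀ ℤ) : ℤ := μ.sum fun _ c => c

/-- Expected value `E_ν[f] = (1/ν(Γ)) Σ ν(a,b) f(a,b)`. -/
def expVal (ν : ℤ × ℤ →₀ ℤ) (f : ℤ × ℤ → ℚ) : ℚ :=
  (mass ν : ℚ)⁻¹ * ν.sum fun p c => (c : ℚ) * f p

/-- Covariance `Cov_ν(f,g) = E_ν[f·g] - E_ν[f]·E_ν[g]`. -/
def cov (ν : ℤ × ℤ →₀ ℤ) (f g : ℤ × ℤ → ℚ) : ℚ :=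
  expVal ν (fun p => f p * g p) - expVal ν f * expVal ν g

/-- Variance `Var_ν(f) = Cov_ν(f,f)`. -/
def var (ν : ℤ × ℤ →₀ ℤ) (f : ℤ × ℤ → ℚ) : ℚ := cov ν f f

/-- The coordinate function `a` (the degree). -/
def fa : ℤ × ℤ → ℚ := fun p => (p.1 : ℚ)

/-- The coordinate function `b`. -/
def fb : ℤ × ℤ → ℚ := fun p => (p.2 : ℚ)

/-- The finite-weight coordinate `a - b`. -/
def fab : ℤ × ℤ → ℚ := fun p => (p.1 : ℚ) - (p.2 : ℚ)

/-- `μ_{N,0}`: start from `δ_{(0,0)}`, apply `D₀` at odd steps and `D₁` at even steps. -/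
def mu0 (m n : ℕ) : ℕ → (ℤ × ℤ →₀ ℤ)
  | 0 => Finsupp.single (0, 0) 1
  | N + 1 => if N % 2 = 0 then D0 m (mu0 m n N) else D1 n (mu0 m n N)

/-- `μ_{N,1}`: start from `δ_{(0,0)}`, apply `D₁` at odd steps and `D₀` at even steps. -/
def mu1 (m n : ℕ) : ℕ → (ℤ × ℤ →₀ ℤ)
  | 0 => Finsupp.single (0, 0) 1
  | N + 1 => if N % 2 = 0 then D1 n (mu1 m n N) else D0 m (mu1 m n N)

/-- The position of `j` relative to the index range of a signed sum up to `k`: it occurs with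
sign `+1` in the first case and with sign `-1` in the second. -/
def InSignedRange (j k : ℤ) : Prop := (0 ≤ j ∧ j ≤ k) ∨ (k < j ∧ j < 0)

lemma InSignedRange.mul_sub_nonneg {j k : ℤ} (h : InSignedRange j k) : 0 ≤ j * (k - j) := by
  rcases h with ⟨h₁, h₂⟩ | ⟨h₁, h₂⟩
  · exact mul_nonneg h₁ (by omega)
  · exact mul_nonneg_of_nonpos_of_nonpos (by omega) (by omega)

lemma signedSum_single_apply {α : Type*} (g : ℤ → α) (k : ℤ) (q : α) :
    signedSum (fun i => Finsupp.single (g i) (1 : ℤ)) k q =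
      (∑ i ∈ Finset.range (k + 1).toNat, Finsupp.single (g i) (1 : ℤ) q) -
        ∑ i ∈ Finset.range (-(k + 1)).toNat, Finsupp.single (g (-((i : ℤ) + 1))) (1 : ℤ) q := by
  simp only [signedSum, Finsupp.sub_apply, Finsupp.finsetSum_apply]

lemma exists_of_signedSum_single_apply_ne_zero {α : Type*} {g : ℤ → α} {k : ℤ} {q : α}
    (h : signedSum (fun i => Finsupp.single (g i) (1 : ℤ)) k q ≠ 0) :
    ∃ j, g j = q ∧ InSignedRange j k := by
  classical
  contrapose! h
  rw [signedSum_single_apply, Finset.sum_eq_zero, Finset.sum_eq_zero, sub_zero]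
  · intro i hi
    rw [Finset.mem_range] at hi
    exact Finsupp.single_eq_of_ne' fun e => h _ e (Or.inr ⟨by omega, by omega⟩)
  · intro i hi
    rw [Finset.mem_range] at hi
    exact Finsupp.single_eq_of_ne' fun e => h _ e (Or.inl ⟨by omega, by omega⟩)

lemma signedSum_single_apply_eq_one {α : Type*} {g : ℤ → α} (hg : Function.Injective g)
    {j k : ℤ} (hj : 0 ≤ j) (hjk : j ≤ k) :
    signedSum (fun i => Finsupp.single (g i) (1 : ℤ)) k (g j) = 1 := by
  classical
  rw [signedSum_single_apply, Finset.sum_eq_single_of_mem j.toNat,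
    show (-(k + 1)).toNat = 0 by omega]
  · simp [Int.toNat_of_nonneg hj]
  · rw [Finset.mem_range]
    omega
  · intro i _ hi
    exact Finsupp.single_eq_of_ne' fun e => hi (by have := hg e; omega)

section StringOperator

variable {α : Type*} (g : α → ℤ → α) (k : α → ℤ)

/-- The operator replacing each point mass at `p` by the signed sum of the point masses along the
string `g p` up to `k p`. -/
def stringOperator (μ : α →₀ ℤ) : α →₀ ℤ :=
  μ.sum fun p c => c • signedSum (fun i => Finsupp.single (g p i) (1 : ℤ)) (k p)

lemma stringOperator_apply (μ : α →₀ ℤ) (q : α) :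
    stringOperator g k μ q =
      ∑ p ∈ μ.support, μ p * signedSum (fun i => Finsupp.single (g p i) (1 : ℤ)) (k p) q := by
  simp only [stringOperator, Finsupp.sum, Finsupp.finsetSum_apply, Finsupp.smul_apply, smul_eq_mul]

variable {g k}

lemma exists_of_mem_support_stringOperator {μ : α →₀ ℤ} {q : α}
    (hq : q ∈ (stringOperator g k μ).support) :
    ∃ p ∈ μ.support, ∃ j, g p j = q ∧ InSignedRange j (k p) := by
  rw [Finsupp.mem_support_iff, stringOperator_apply] at hq
  obtain ⟨p, hp, h⟩ := Finset.exists_ne_zero_of_sum_ne_zero hq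
  exact ⟨p, hp, exists_of_signedSum_single_apply_ne_zero (right_ne_zero_of_mul h)⟩

lemma stringOperator_apply_of_unique {μ : α →₀ ℤ} {p : α} {j : ℤ}
    (hg : Function.Injective (g p)) (hj : 0 ≤ j) (hjk : j ≤ k p)
    (huniq : ∀ p' ∈ μ.support, ∀ i, g p' i = g p j → InSignedRange i (k p') → p' = p) :
    stringOperator g k μ (g p j) = μ p := by
  classical
  rw [stringOperator_apply, Finset.sum_eq_single p]
  · rw [signedSum_single_apply_eq_one hg hj hjk, mul_one]
  · intro p' hp' hne
    by_contra h
    obtain ⟨i, hi, hr⟩ := exists_of_signedSum_single_apply_ne_zero (right_ne_zero_of_mul h)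
    exact hne (huniq p' hp' i hi hr)
  · intro hp
    rw [Finsupp.notMem_support_iff.mp hp, zero_mul]

end StringOperator

/-- Half the drop in squared length from `Λ` to `Λ - a α₀ - b α₁`. -/
def normDrop (m n : ℕ) (p : ℤ × ℤ) : ℤ := p.1 * m + p.2 * n - (p.1 - p.2) ^ 2

/-- The weight encoded by `(A, B)` has the same length as `Λ`, occurs with multiplicity one in
`μ`, and bounds both coordinates on the support of `μ`, all of whose weights are no longer
than `Λ`. -/
structure IsExtremalWeight (m n : ℕ) (μ : ℤ × ℤ →₀ ℤ) (A B : ℤ) : Prop where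
  normDrop_eq_zero : normDrop m n (A, B) = 0
  apply_eq_one : μ (A, B) = 1
  normDrop_nonneg : ∀ p ∈ μ.support, 0 ≤ normDrop m n p
  fst_le : ∀ p ∈ μ.support, p.1 ≤ A
  snd_le : ∀ p ∈ μ.support, p.2 ≤ B

lemma isExtremalWeight_single (m n : ℕ) :
    IsExtremalWeight m n (Finsupp.single (0, 0) 1) 0 0 := by
  have h : ∀ p ∈ (Finsupp.single ((0 : ℤ), (0 : ℤ)) (1 : ℤ)).support, p = (0, 0) := fun p hp =>
    Finset.mem_singleton.mp (Finsupp.support_single_subset hp)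
  constructor
  · simp [normDrop]
  · simp
  · intro p hp
    simp [h p hp, normDrop]
  · intro p hp
    simp [h p hp]
  · intro p hp
    simp [h p hp]

lemma fst_le_of_normDrop_nonneg {m n : ℕ} {A B a b : ℤ} (h₀ : normDrop m n (A, B) = 0)
    (hAB : (m : ℤ) ≤ 2 * (A - B)) (h : 0 ≤ normDrop m n (a, b)) (hb : b ≤ B) : a ≤ A := by
  by_contra! ha
  obtain ⟨x, rfl⟩ : ∃ x, a = A + x := ⟨a - A, by ring⟩
  obtain ⟨y, rfl⟩ : ∃ y, b = B - y := ⟨B - b, by ring⟩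
  have hx : 0 < x := by omega
  have hy : 0 ≤ y := by omega
  simp only [normDrop] at h₀ h
  nlinarith [mul_nonneg hx.le (sub_nonneg.mpr hAB), mul_nonneg hy (sub_nonneg.mpr hAB),
    mul_nonneg hy (Nat.cast_nonneg (α := ℤ) n), mul_nonneg hy (Nat.cast_nonneg (α := ℤ) m),
    sq_pos_of_pos (by omega : 0 < x + y)]

lemma normDrop_swap (m n : ℕ) (a b : ℤ) : normDrop n m (b, a) = normDrop m n (a, b) := by
  simp only [normDrop]
  ring

lemma snd_le_of_normDrop_nonneg {m n : ℕ} {A B a b : ℤ} (h₀ : normDrop m n (A, B) = 0)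
    (hAB : (n : ℤ) ≤ 2 * (B - A)) (h : 0 ≤ normDrop m n (a, b)) (ha : a ≤ A) : b ≤ B :=
  fst_le_of_normDrop_nonneg ((normDrop_swap m n A B).trans h₀) hAB
    (h.trans_eq (normDrop_swap m n a b).symm) ha

lemma normDrop_add_fst (m n : ℕ) (a b j : ℤ) :
    normDrop m n (a + j, b) = normDrop m n (a, b) + j * (m - 2 * (a - b) - j) := by
  simp only [normDrop]
  ring

lemma normDrop_add_snd (m n : ℕ) (a b j : ℤ) :
    normDrop m n (a, b + j) = normDrop m n (a, b) + j * (n + 2 * (a - b) - j) := by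
  simp only [normDrop]
  ring

lemma IsExtremalWeight.D0 {m n : ℕ} {μ : ℤ × ℤ →₀ ℤ} {A B : ℤ}
    (h : IsExtremalWeight m n μ A B) (hAB : 0 ≤ (m : ℤ) - 2 * (A - B)) :
    IsExtremalWeight m n (D0 m μ) (A + (m - 2 * (A - B))) B := by
  have hD : _root_.D0 m μ = stringOperator (fun p i => (p.1 + i, p.2))
    (fun p => (m : ℤ) - 2 * (p.1 - p.2)) μ := rfl
  have hQ : normDrop m n (A + (m - 2 * (A - B)), B) = 0 := by
    rw [normDrop_add_fst, h.normDrop_eq_zero]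
    ring
  have hnonneg : ∀ p ∈ (_root_.D0 m μ).support, 0 ≤ normDrop m n p := by
    intro q hq
    rw [hD] at hq
    obtain ⟨⟨a, b⟩, hp, j, rfl, hj⟩ := exists_of_mem_support_stringOperator hq
    rw [normDrop_add_fst]
    exact add_nonneg (h.normDrop_nonneg _ hp) hj.mul_sub_nonneg
  have hsnd : ∀ p ∈ (_root_.D0 m μ).support, p.2 ≤ B := by
    intro q hq
    rw [hD] at hq
    obtain ⟨p, hp, j, rfl, -⟩ := exists_of_mem_support_stringOperator hq
    exact h.snd_le p hp
  refine ⟨hQ, ?_, hnonneg, fun p hp => ?_, hsnd⟩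
  · rw [hD, ← h.apply_eq_one]
    refine stringOperator_apply_of_unique (p := (A, B)) (fun i j hij => ?_) hAB le_rfl ?_
    · simpa using hij
    · rintro ⟨a, b⟩ hp i hi hr
      simp only [Prod.mk.injEq] at hi ⊢
      obtain ⟨hi, rfl⟩ := hi
      have hle := h.fst_le _ hp
      have hrefl : 0 ≤ normDrop m n (a + (m - 2 * (a - b)), b) := by
        rw [normDrop_add_fst, sub_self, mul_zero, add_zero]
        exact h.normDrop_nonneg _ hp
      have hge := fst_le_of_normDrop_nonneg hQ (by omega) hrefl le_rfl
      simp only [InSignedRange] at hr hle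
      omega
  · exact fst_le_of_normDrop_nonneg hQ (by omega) (hnonneg p hp) (hsnd p hp)

lemma IsExtremalWeight.D1 {m n : ℕ} {μ : ℤ × ℤ →₀ ℤ} {A B : ℤ}
    (h : IsExtremalWeight m n μ A B) (hAB : 0 ≤ (n : ℤ) + 2 * (A - B)) :
    IsExtremalWeight m n (D1 n μ) A (B + (n + 2 * (A - B))) := by
  have hD : _root_.D1 n μ = stringOperator (fun p i => (p.1, p.2 + i))
    (fun p => (n : ℤ) + 2 * (p.1 - p.2)) μ := rfl
  have hQ : normDrop m n (A, B + (n + 2 * (A - B))) = 0 := by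
    rw [normDrop_add_snd, h.normDrop_eq_zero]
    ring
  have hnonneg : ∀ p ∈ (_root_.D1 n μ).support, 0 ≤ normDrop m n p := by
    intro q hq
    rw [hD] at hq
    obtain ⟨⟨a, b⟩, hp, j, rfl, hj⟩ := exists_of_mem_support_stringOperator hq
    rw [normDrop_add_snd]
    exact add_nonneg (h.normDrop_nonneg _ hp) hj.mul_sub_nonneg
  have hfst : ∀ p ∈ (_root_.D1 n μ).support, p.1 ≤ A := by
    intro q hq
    rw [hD] at hq
    obtain ⟨p, hp, j, rfl, -⟩ := exists_of_mem_support_stringOperator hq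
    exact h.fst_le p hp
  refine ⟨hQ, ?_, hnonneg, hfst, fun p hp => ?_⟩
  · rw [hD, ← h.apply_eq_one]
    refine stringOperator_apply_of_unique (p := (A, B)) (fun i j hij => ?_) hAB le_rfl ?_
    · simpa using hij
    · rintro ⟨a, b⟩ hp i hi hr
      simp only [Prod.mk.injEq] at hi ⊢
      obtain ⟨rfl, hi⟩ := hi
      have hle := h.snd_le _ hp
      have hrefl : 0 ≤ normDrop m n (a, b + (n + 2 * (a - b))) := by
        rw [normDrop_add_snd, sub_self, mul_zero, add_zero]
        exact h.normDrop_nonneg _ hp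
      have hge := snd_le_of_normDrop_nonneg hQ (by omega) hrefl le_rfl
      simp only [InSignedRange] at hr hle
      omega
  · exact snd_le_of_normDrop_nonneg hQ (by omega) (hnonneg p hp) (hfst p hp)

lemma IsExtremalWeight.max_fst {m n : ℕ} {μ : ℤ × ℤ →₀ ℤ} {A B : ℤ}
    (h : IsExtremalWeight m n μ A B) : (μ.support.image Prod.fst).max = A := by
  refine le_antisymm (Finset.max_le fun a ha => ?_) (Finset.le_max (Finset.mem_image.mpr
    ⟨(A, B), Finsupp.mem_support_iff.mpr (by simp [h.apply_eq_one]), rfl⟩))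
  obtain ⟨p, hp, rfl⟩ := Finset.mem_image.mp ha
  exact WithBot.coe_le_coe.mpr (h.fst_le p hp)

lemma mu0_odd (m n M : ℕ) : mu0 m n (2 * M + 1) = D0 m (mu0 m n (2 * M)) := by
  simp [mu0]

lemma mu0_even_succ (m n M : ℕ) : mu0 m n (2 * (M + 1)) = D1 n (mu0 m n (2 * M + 1)) := by
  rw [show 2 * (M + 1) = 2 * M + 1 + 1 by ring, mu0, if_neg (by omega)]

lemma mu1_odd (m n M : ℕ) : mu1 m n (2 * M + 1) = D1 n (mu1 m n (2 * M)) := by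
  simp [mu1]

lemma mu1_even_succ (m n M : ℕ) : mu1 m n (2 * (M + 1)) = D0 m (mu1 m n (2 * M + 1)) := by
  rw [show 2 * (M + 1) = 2 * M + 1 + 1 by ring, mu1, if_neg (by omega)]

/-- The extremal weight of `μ_{2M+1,0}`, given that of `μ_{2M,0}`. -/
lemma IsExtremalWeight.mu0_odd {m n M : ℕ} {A : ℤ}
    (h : IsExtremalWeight m n (mu0 m n (2 * M)) A (A + M * (m + n))) :
    IsExtremalWeight m n (mu0 m n (2 * M + 1)) (A + m + 2 * M * (m + n)) (A + M * (m + n)) := by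
  have h' := h.D0 (by ring_nf; positivity)
  rw [← _root_.mu0_odd] at h'
  convert h' using 1
  ring

lemma isExtremalWeight_mu0_even (m n M : ℕ) :
    IsExtremalWeight m n (mu0 m n (2 * M)) (M * m + (m + n) * (M - 1) * M)
      (M * m + (m + n) * (M - 1) * M + M * (m + n)) := by
  induction M with
  | zero => simpa [mu0] using isExtremalWeight_single m n
  | succ M ih =>
    have h := ih.mu0_odd.D1 (by ring_nf; positivity)
    rw [← mu0_even_succ] at h
    convert h using 1 <;> push_cast <;> ring

/-- The extremal weight of `μ_{2M+1,1}`, given that of `μ_{2M,1}`. -/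
lemma IsExtremalWeight.mu1_odd {m n M : ℕ} {A : ℤ}
    (h : IsExtremalWeight m n (mu1 m n (2 * M)) A (A - M * (m + n))) :
    IsExtremalWeight m n (mu1 m n (2 * M + 1)) A (A + n + M * (m + n)) := by
  have h' := h.D1 (by ring_nf; positivity)
  rw [← _root_.mu1_odd] at h'
  convert h' using 1
  ring

lemma isExtremalWeight_mu1_even (m n M : ℕ) :
    IsExtremalWeight m n (mu1 m n (2 * M)) (M * (m + 2 * n) + (m + n) * (M - 1) * M)
      (M * (m + 2 * n) + (m + n) * (M - 1) * M - M * (m + n)) := by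
  induction M with
  | zero => simpa [mu1] using isExtremalWeight_single m n
  | succ M ih =>
    have h := ih.mu1_odd.D0 (by ring_nf; positivity)
    rw [← mu1_even_succ] at h
    convert h using 1 <;> push_cast <;> ring

/-- maximal degree: the maximum of the coordinate `a` over the support of
`μ_{N,0}` is `⌈N/2⌉m + (m+n)(⌈N/2⌉-1)⌈N/2⌉`, and over the support of `μ_{N,1}` it is
`⌊N/2⌋(m+2n) + (m+n)(⌊N/2⌋-1)⌊N/2⌋`. -/
theorem stmt_17 (m n : ℕ) (N : ℕ) :
    (((mu0 m n N).support.image Prod.fst).max =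
      ((((N + 1) / 2 : ℕ) : ℤ) * (m : ℤ) +
        ((m : ℤ) + (n : ℤ)) * ((((N + 1) / 2 : ℕ) : ℤ) - 1) * (((N + 1) / 2 : ℕ) : ℤ) :
          ℤ)) ∧
    (((mu1 m n N).support.image Prod.fst).max =
      (((N / 2 : ℕ) : ℤ) * ((m : ℤ) + 2 * (n : ℤ)) +
        ((m : ℤ) + (n : ℤ)) * (((N / 2 : ℕ) : ℤ) - 1) * ((N / 2 : ℕ) : ℤ) : ℤ)) := by
  obtain ⟨M, rfl | rfl⟩ := Nat.even_or_odd' N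
  · rw [show (2 * M + 1) / 2 = M by omega, show 2 * M / 2 = M by omega]
    exact ⟨(isExtremalWeight_mu0_even m n M).max_fst, (isExtremalWeight_mu1_even m n M).max_fst⟩
  · rw [show (2 * M + 1 + 1) / 2 = M + 1 by omega, show (2 * M + 1) / 2 = M by omega]
    refine ⟨(isExtremalWeight_mu0_even m n M).mu0_odd.max_fst.trans (congrArg _ ?_),
      (isExtremalWeight_mu1_even m n M).mu1_odd.max_fst⟩
    push_cast
    ring
end
end

section
/- (Asymptotics in N.) Assume m + n ≥ 1 and let j ∈ {0,1}. Then the ratio of the expected degree to the maximal degree in the N-th Demazure measure converges: lim_{N→∞} E_{μ_{N,j}}[a] / A^{m,n}_{N,j} = (m+n+2) / ( 3(m+n+1) ), where A^{m,n}_{N,0} = ⌈N/2⌉·m + (m+n)·(⌈N/2⌉ − 1)·⌈N/2⌉ and A^{m,n}_{N,1} = ⌊N/2⌋·(m+2n) + (m+n)·(⌊N/2⌋ − 1)·⌊N/2⌋ denote the maximal degrees. -/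
open Finsupp Filter

noncomputable section

/-- The pairing `Σ ν(p) f(p)`, additive in the measure. -/
def pairing (f : ℤ × ℤ → ℚ) : (ℤ × ℤ →₀ ℤ) →+ ℚ :=
  Finsupp.liftAddHom fun p => zmultiplesHom ℚ (f p)

lemma pairing_apply (f : ℤ × ℤ → ℚ) (ν : ℤ × ℤ →₀ ℤ) :
    pairing f ν = ν.sum fun p c => (c : ℚ) * f p := by
  change (ν.sum fun p c => zmultiplesHom ℚ (f p) c) = _
  simp

lemma pairing_single (f : ℤ × ℤ → ℚ) (p : ℤ × ℤ) (c : ℤ) :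
    pairing f (Finsupp.single p c) = (c : ℚ) * f p := by
  simp [pairing]

lemma pairing_add (f g : ℤ × ℤ → ℚ) (ν : ℤ × ℤ →₀ ℤ) :
    pairing (f + g) ν = pairing f ν + pairing g ν := by
  simp only [pairing_apply, Finsupp.sum, Pi.add_apply, mul_add, Finset.sum_add_distrib]

lemma pairing_smul (x : ℚ) (f : ℤ × ℤ → ℚ) (ν : ℤ × ℤ →₀ ℤ) :
    pairing (x • f) ν = x * pairing f ν := by
  simp only [pairing_apply, Finsupp.sum, Pi.smul_apply, smul_eq_mul, Finset.mul_sum,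
    mul_left_comm]

lemma mass_cast (ν : ℤ × ℤ →₀ ℤ) : (mass ν : ℚ) = pairing 1 ν := by
  simp [pairing_apply, mass, Finsupp.sum]

lemma expVal_eq (ν : ℤ × ℤ →₀ ℤ) (f : ℤ × ℤ → ℚ) :
    expVal ν f = pairing f ν / pairing 1 ν := by
  rw [expVal, mass_cast, pairing_apply f, div_eq_inv_mul]

lemma map_signedSum {M N : Type*} [AddCommGroup M] [AddCommGroup N] (φ : M →+ N)
    (c : ℤ → M) (k : ℤ) : φ (signedSum c k) = signedSum (fun i => φ (c i)) k := by
  simp [signedSum]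

/-- Discrete fundamental theorem of calculus for signed sums. -/
lemma signedSum_eq_sub {M : Type*} [AddCommGroup M] {c F : ℤ → M}
    (h : ∀ i, c i = F (i + 1) - F i) (k : ℤ) : signedSum c k = F (k + 1) - F 0 := by
  have h₁ (r : ℕ) : ∑ i ∈ Finset.range r, c i = F r - F 0 := by
    simpa [h] using Finset.sum_range_sub (fun i : ℕ => F i) r
  have h₂ (r : ℕ) : ∑ i ∈ Finset.range r, c (-((i : ℤ) + 1)) = F 0 - F (-r) := by
    simpa [h] using Finset.sum_range_sub' (fun i : ℕ => F (-i)) r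
  rw [signedSum, h₁, h₂]
  rcases le_total 0 (k + 1) with hk | hk
  · rw [Int.toNat_of_nonneg hk, Int.toNat_of_nonpos (by omega)]; simp
  · rw [Int.toNat_of_nonpos hk, Int.toNat_of_nonneg (by omega)]; simp

/-- Moments of `D₀ μ`, by summing `f` along the strings in direction `α₀` with the help of a
discrete antiderivative `F` of `f`. -/
lemma pairing_D0 (m : ℕ) (μ : ℤ × ℤ →₀ ℤ) {f g : ℤ × ℤ → ℚ} (F : ℤ × ℤ → ℚ)
    (hF : ∀ a b : ℤ, f (a, b) = F (a + 1, b) - F (a, b))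
    (hg : ∀ a b : ℤ, g (a, b) = F (m + 2 * b - a + 1, b) - F (a, b)) :
    pairing f (D0 m μ) = pairing g μ := by
  rw [D0, map_finsuppSum, pairing_apply g]
  refine Finsupp.sum_congr fun ⟨a, b⟩ _ => ?_
  rw [map_zsmul, map_signedSum, zsmul_eq_mul,
    signedSum_eq_sub (F := fun i => F (a + i, b)) fun i => ?_, hg]
  · congr 3 <;> ring_nf
  · simp [pairing_single, hF, add_assoc]

/-- Moments of `D₁ μ`, by summing `f` along the strings in direction `α₁` with the help of a
discrete antiderivative `F` of `f`. -/
lemma pairing_D1 (n : ℕ) (μ : ℤ × ℤ →₀ ℤ) {f g : ℤ × ℤ → ℚ} (F : ℤ × ℤ → ℚ)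
    (hF : ∀ a b : ℤ, f (a, b) = F (a, b + 1) - F (a, b))
    (hg : ∀ a b : ℤ, g (a, b) = F (a, n + 2 * a - b + 1) - F (a, b)) :
    pairing f (D1 n μ) = pairing g μ := by
  rw [D1, map_finsuppSum, pairing_apply g]
  refine Finsupp.sum_congr fun ⟨a, b⟩ _ => ?_
  rw [map_zsmul, map_signedSum, zsmul_eq_mul,
    signedSum_eq_sub (F := fun i => F (a, b + i)) fun i => ?_, hg]
  · congr 3 <;> ring_nf
  · simp [pairing_single, hF, add_assoc]

/-- The finite-weight coordinate recentred at `x / 2`. -/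
def centred (x : ℚ) : ℤ × ℤ → ℚ := fun p => p.1 - p.2 - x / 2

lemma pairing_zero (ν : ℤ × ℤ →₀ ℤ) : pairing 0 ν = 0 := by
  simp [pairing_apply]

section Moments

variable (m n : ℕ) (μ : ℤ × ℤ →₀ ℤ)

lemma pairing_centred_D0 : pairing (centred m) (D0 m μ) = 0 := by
  rw [← pairing_zero μ]
  refine pairing_D0 m μ (fun p => (p.1 - p.2 - m / 2 : ℚ) * (p.1 - p.2 - m / 2 - 1) / 2) ?_ ?_ <;>
  · intro a b; simp [centred]; ring

lemma pairing_centred_mul_D0 : pairing (centred m * fb) (D0 m μ) = 0 := by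
  rw [← pairing_zero μ]
  refine pairing_D0 m μ
    (fun p => (p.1 - p.2 - m / 2 : ℚ) * (p.1 - p.2 - m / 2 - 1) / 2 * p.2) ?_ ?_ <;>
  · intro a b; simp [centred, fb]; ring

lemma pairing_centred_pow_three_D0 : pairing (centred m ^ 3) (D0 m μ) = 0 := by
  rw [← pairing_zero μ]
  refine pairing_D0 m μ
    (fun p => ((p.1 - p.2 - m / 2 : ℚ) * (p.1 - p.2 - m / 2 - 1) / 2) ^ 2) ?_ ?_ <;>
  · intro a b; simp [centred]; ring

lemma pairing_centred_D1 : pairing (centred (-n)) (D1 n μ) = 0 := by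
  rw [← pairing_zero μ]
  refine pairing_D1 n μ
    (fun p => -((p.1 - p.2 + n / 2 : ℚ) * (p.1 - p.2 + n / 2 + 1) / 2)) ?_ ?_ <;>
  · intro a b; simp [centred]; ring

lemma pairing_centred_mul_D1 : pairing (centred (-n) * fa) (D1 n μ) = 0 := by
  rw [← pairing_zero μ]
  refine pairing_D1 n μ
    (fun p => -((p.1 - p.2 + n / 2 : ℚ) * (p.1 - p.2 + n / 2 + 1) / 2 * p.1)) ?_ ?_ <;>
  · intro a b; simp [centred, fa]; ring

lemma pairing_centred_pow_three_D1 : pairing (centred (-n) ^ 3) (D1 n μ) = 0 := by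
  rw [← pairing_zero μ]
  refine pairing_D1 n μ
    (fun p => -((p.1 - p.2 + n / 2 : ℚ) * (p.1 - p.2 + n / 2 + 1) / 2) ^ 2) ?_ ?_ <;>
  · intro a b; simp [centred]; ring

lemma pairing_one_D0 :
    pairing 1 (D0 m μ) = pairing ((m + 1 : ℚ) • 1 + (-2 : ℚ) • centred 0) μ := by
  refine pairing_D0 m μ (fun p => p.1) ?_ ?_ <;>
  · intro a b; simp [centred]; try ring

lemma pairing_one_D1 :
    pairing 1 (D1 n μ) = pairing ((n + 1 : ℚ) • 1 + (2 : ℚ) • centred 0) μ := by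
  refine pairing_D1 n μ (fun p => p.2) ?_ ?_ <;>
  · intro a b; simp [centred]; try ring

lemma pairing_one_D1_D0 :
    pairing 1 (D1 n (D0 m μ)) = (m + n + 1) * pairing 1 (D0 m μ) := by
  have h : ((n + 1 : ℚ) • 1 + (2 : ℚ) • centred 0) =
      ((m + n + 1 : ℚ) • 1 + (2 : ℚ) • centred m) := by
    ext p; simp [centred]; ring
  rw [pairing_one_D1, h, pairing_add, pairing_smul, pairing_smul, pairing_centred_D0]
  ring

lemma pairing_one_D0_D1 :
    pairing 1 (D0 m (D1 n μ)) = (m + n + 1) * pairing 1 (D1 n μ) := by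
  have h : ((m + 1 : ℚ) • 1 + (-2 : ℚ) • centred 0) =
      ((m + n + 1 : ℚ) • 1 + (-2 : ℚ) • centred (-n)) := by
    ext p; simp [centred]; ring
  rw [pairing_one_D0, h, pairing_add, pairing_smul, pairing_smul, pairing_centred_D1]
  ring

lemma pairing_fa_D1_D0 :
    pairing fa (D1 n (D0 m μ)) =
      (m + n + 1) * pairing fa (D0 m μ) + 2 * pairing (centred m ^ 2) (D0 m μ) := by
  have h : pairing fa (D1 n (D0 m μ)) = pairing ((m + n + 1 : ℚ) • fa + (2 : ℚ) • centred m ^ 2 +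
      (m : ℚ) • centred m + (2 : ℚ) • (centred m * fb)) (D0 m μ) := by
    refine pairing_D1 n _ (fun p => p.1 * p.2) ?_ ?_ <;>
    · intro a b; simp [centred, fa, fb]; ring
  rw [h]
  simp only [pairing_add, pairing_smul, pairing_centred_D0, pairing_centred_mul_D0]
  ring

lemma pairing_fa_D0_D1 :
    pairing fa (D0 m (D1 n μ)) =
      (m + n + 1) * pairing fa (D1 n μ) + 2 * pairing (centred (-n) ^ 2) (D1 n μ) +
        (m + n) * (m + n + 1) / 2 * pairing 1 (D1 n μ) := by
  have h : pairing fa (D0 m (D1 n μ)) = pairing ((m + n + 1 : ℚ) • fa +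
      (2 : ℚ) • centred (-n) ^ 2 + ((m + n) * (m + n + 1) / 2 : ℚ) • 1 +
      (-2 * (m + n) - 1 : ℚ) • centred (-n) + (-2 : ℚ) • (centred (-n) * fa)) (D1 n μ) := by
    refine pairing_D0 m _ (fun p => p.1 * (p.1 - 1) / 2) ?_ ?_ <;>
    · intro a b; simp [centred, fa]; ring
  rw [h]
  simp only [pairing_add, pairing_smul, pairing_centred_D1, pairing_centred_mul_D1]
  ring

lemma pairing_centred_sq_D1_D0 :
    pairing (centred (-n) ^ 2) (D1 n (D0 m μ)) =
      (m + n + 1) * pairing (centred m ^ 2) (D0 m μ) +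
        (m + n) * (m + n + 1) * (m + n + 2) / 12 * pairing 1 (D0 m μ) := by
  have h : pairing (centred (-n) ^ 2) (D1 n (D0 m μ)) =
      pairing ((m + n + 1 : ℚ) • centred m ^ 2 +
        ((m + n) * (m + n + 1) * (m + n + 2) / 12 : ℚ) • 1 +
        ((3 * (m + n) ^ 2 + 6 * (m + n) + 2) / 6 : ℚ) • centred m +
        (2 / 3 : ℚ) • centred m ^ 3) (D0 m μ) := by
    refine pairing_D1 n _ (fun p => -((p.1 - p.2 + n / 2 : ℚ) * (p.1 - p.2 + n / 2 + 1) *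
      (2 * (p.1 - p.2 + n / 2) + 1) / 6)) ?_ ?_ <;>
    · intro a b; simp [centred]; ring
  rw [h]
  simp only [pairing_add, pairing_smul, pairing_centred_D0, pairing_centred_pow_three_D0]
  ring

lemma pairing_centred_sq_D0_D1 :
    pairing (centred m ^ 2) (D0 m (D1 n μ)) =
      (m + n + 1) * pairing (centred (-n) ^ 2) (D1 n μ) +
        (m + n) * (m + n + 1) * (m + n + 2) / 12 * pairing 1 (D1 n μ) := by
  have h : pairing (centred m ^ 2) (D0 m (D1 n μ)) =
      pairing ((m + n + 1 : ℚ) • centred (-n) ^ 2 +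
        ((m + n) * (m + n + 1) * (m + n + 2) / 12 : ℚ) • 1 +
        (-(3 * (m + n) ^ 2 + 6 * (m + n) + 2) / 6 : ℚ) • centred (-n) +
        (-2 / 3 : ℚ) • centred (-n) ^ 3) (D1 n μ) := by
    refine pairing_D0 m _ (fun p => (p.1 - p.2 - m / 2 : ℚ) * (p.1 - p.2 - m / 2 - 1) *
      (2 * (p.1 - p.2 - m / 2) - 1) / 6) ?_ ?_ <;>
    · intro a b; simp [centred]; ring
  rw [h]
  simp only [pairing_add, pairing_smul, pairing_centred_D1, pairing_centred_pow_three_D1]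
  ring

end Moments

/-- The expected degree along a sequence of measures obtained by applying `D₀` and `D₁`
alternately is quadratic in the number of steps, up to a multiple of the number `h` of
applications of `D₀`. -/
lemma expVal_fa_of_alternating (m n : ℕ) {P : ℕ → Prop} [DecidablePred P]
    (hP : ∀ N, P (N + 1) ↔ ¬ P N) {X : ℕ → (ℤ × ℤ →₀ ℤ)}
    (hX : ∀ N, X (N + 1) = if P N then D0 m (X N) else D1 n (X N))
    (hX₁ : pairing 1 (X 1) ≠ 0) {h : ℕ → ℕ} (hh : ∀ N, h (N + 1) = h N + if P N then 1 else 0) :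
    ∃ α β : ℚ, ∀ N : ℕ, expVal (X (N + 1)) fa =
      α + β * N + (m + n) * (m + n + 2) / (12 * (m + n + 1)) * (N : ℚ) ^ 2 +
        (m + n) / 2 * (h (N + 1) : ℚ) := by
  have hd : (m + n + 1 : ℚ) ≠ 0 := by positivity
  set w : ℕ → ℤ × ℤ → ℚ := fun N => if P N then centred m else centred (-n)
  set v : ℕ → ℚ := fun N => expVal (X (N + 1)) (w N ^ 2)
  have step (N : ℕ) : pairing 1 (X (N + 2)) = (m + n + 1) * pairing 1 (X (N + 1)) ∧
      pairing (w (N + 1) ^ 2) (X (N + 2)) = (m + n + 1) * pairing (w N ^ 2) (X (N + 1)) +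
        (m + n) * (m + n + 1) * (m + n + 2) / 12 * pairing 1 (X (N + 1)) ∧
      pairing fa (X (N + 2)) = (m + n + 1) * pairing fa (X (N + 1)) +
        2 * pairing (w N ^ 2) (X (N + 1)) +
        ((h (N + 2) : ℚ) - h (N + 1)) * ((m + n) * (m + n + 1) / 2 * pairing 1 (X (N + 1))) := by
    by_cases p : P N
    · have q : ¬ P (N + 1) := by simpa [hP] using p
      simp only [w, hX (N + 1), hX N, hh (N + 1), if_pos p, if_neg q, pairing_one_D1_D0,
        pairing_centred_sq_D1_D0, pairing_fa_D1_D0]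
      simp
    · have q : P (N + 1) := by simpa [hP] using p
      simp only [w, hX (N + 1), hX N, hh (N + 1), if_pos q, if_neg p, pairing_one_D0_D1,
        pairing_centred_sq_D0_D1, pairing_fa_D0_D1]
      simp
  have mass_ne (N : ℕ) : pairing 1 (X (N + 1)) ≠ 0 := by
    induction N with
    | zero => exact hX₁
    | succ N ih => rw [(step N).1]; exact mul_ne_zero hd ih
  have hv (N : ℕ) : v N = v 0 + N * ((m + n) * (m + n + 2) / 12) := by
    induction N with
    | zero => simp
    | succ N ih =>
      have hN := mass_ne N
      have : v (N + 1) = v N + (m + n) * (m + n + 2) / 12 := by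
        simp only [v, expVal_eq, (step N).1, (step N).2.1]
        field_simp
      rw [this, ih]; push_cast; ring
  refine ⟨expVal (X 1) fa - (m + n) / 2 * h 1,
    (2 * v 0 - (m + n) * (m + n + 2) / 12) / (m + n + 1), fun N => ?_⟩
  induction N with
  | zero => simp
  | succ N ih =>
    have hN := mass_ne N
    have : expVal (X (N + 2)) fa = expVal (X (N + 1)) fa + 2 * v N / (m + n + 1) +
        ((h (N + 2) : ℚ) - h (N + 1)) * ((m + n) / 2) := by
      simp only [v, expVal_eq, (step N).1, (step N).2.2]
      field_simp
    rw [this, ih, hv N]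
    push_cast
    field_simp
    ring

lemma tendsto_inv_natCast_rat : Tendsto (fun N : ℕ => (N : ℚ)⁻¹) atTop (nhds 0) :=
  tendsto_inv_atTop_zero.comp tendsto_natCast_atTop_atTop

/-- A ratio of two quadratic expressions in `N` and in `h N ~ N / 2`. -/
lemma tendsto_quadratic_div {c : ℚ} (hc : c ≠ 0) (α β γ q δ : ℚ) {h e : ℕ → ℚ}
    (hh : ∀ N, |2 * h N - N| ≤ δ)
    (he : ∀ N : ℕ, e N = α + β * N + γ * (N : ℚ) ^ 2 + c / 2 * h N) :
    Tendsto (fun N => e N / (h N * q + c * (h N - 1) * h N)) atTop (nhds (4 * γ / c)) := by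
  have i := tendsto_inv_natCast_rat
  have hlim : Tendsto (fun N : ℕ => h N * (N : ℚ)⁻¹) atTop (nhds (1 / 2)) := by
    have h₀ : Tendsto (fun N : ℕ => (2 * h N - N) * (N : ℚ)⁻¹) atTop (nhds 0) := by
      refine tendsto_of_tendsto_of_tendsto_of_le_of_le (g := fun N : ℕ => -δ * (N : ℚ)⁻¹)
        (h := fun N : ℕ => δ * (N : ℚ)⁻¹) (by simpa using i.const_mul (-δ))
        (by simpa using i.const_mul δ) (fun N => ?_) (fun N => ?_)
      · exact mul_le_mul_of_nonneg_right (abs_le.1 (hh N)).1 (by positivity)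
      · exact mul_le_mul_of_nonneg_right (abs_le.1 (hh N)).2 (by positivity)
    have h₁ := (h₀.add_const 1).div_const 2
    rw [zero_add] at h₁
    refine h₁.congr' ?_
    filter_upwards [eventually_ne_atTop 0] with N hN
    field_simp
    ring
  have hnum := ((i.pow 2).const_mul α).add ((i.const_mul β).add
    ((tendsto_const_nhds (x := γ)).add ((hlim.mul i).const_mul (c / 2))))
  have hden := ((hlim.mul i).mul_const q).add (((hlim.sub i).const_mul c).mul hlim)
  have := hnum.div hden (by simpa using hc)
  refine (this.congr' ?_).trans (le_of_eq ?_)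
  · filter_upwards [eventually_ne_atTop 0] with N hN
    have hN' : (N : ℚ) ≠ 0 := by exact_mod_cast hN
    simp only [Pi.div_apply]
    rw [he]
    refine Eq.trans ?_ (mul_div_mul_right _ _ (pow_ne_zero 2 (inv_ne_zero hN')))
    congr 1
    · field_simp
      ring
    · field_simp
  · congr 1
    norm_num
    field_simp
    norm_num

lemma tendsto_expVal_fa_of_alternating {m n : ℕ} (hmn : 1 ≤ m + n) {P : ℕ → Prop}
    [DecidablePred P] (hP : ∀ N, P (N + 1) ↔ ¬ P N) {X : ℕ → (ℤ × ℤ →₀ ℤ)}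
    (hX₀ : X 0 = Finsupp.single (0, 0) 1)
    (hX : ∀ N, X (N + 1) = if P N then D0 m (X N) else D1 n (X N)) {h : ℕ → ℕ}
    (hh : ∀ N, h (N + 1) = h N + if P N then 1 else 0)
    (hbound : ∀ N, N ≤ 2 * h N + 1 ∧ 2 * h N ≤ N + 1) (q : ℚ) :
    Tendsto (fun N => expVal (X N) fa / ((h N : ℚ) * q + (m + n) * ((h N : ℚ) - 1) * (h N : ℚ)))
      atTop (nhds (((m : ℚ) + (n : ℚ) + 2) / (3 * ((m : ℚ) + (n : ℚ) + 1)))) := by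
  have hX₁ : pairing 1 (X 1) ≠ 0 := by
    rw [hX, hX₀]
    split_ifs
    · rw [pairing_one_D0, pairing_single]
      simp [centred]
      positivity
    · rw [pairing_one_D1, pairing_single]
      simp [centred]
      positivity
  obtain ⟨α, β, H⟩ := expVal_fa_of_alternating m n hP hX hX₁ hh
  have hc : (m + n : ℚ) ≠ 0 := by
    have : m + n ≠ 0 := by omega
    exact_mod_cast this
  have hd : (m + n + 1 : ℚ) ≠ 0 := by positivity
  rw [← tendsto_add_atTop_iff_nat 1]
  convert tendsto_quadratic_div hc α β _ q 2 (h := fun N => (h (N + 1) : ℚ)) ?_ H using 2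
  · field_simp
    ring
  · intro N
    obtain ⟨h₁, h₂⟩ := hbound (N + 1)
    have h₁' : (N : ℚ) + 1 ≤ 2 * h (N + 1) + 1 := by exact_mod_cast h₁
    have h₂' : (2 : ℚ) * h (N + 1) ≤ N + 1 + 1 := by exact_mod_cast h₂
    rw [abs_le]
    constructor <;> linarith

/-- asymptotics in `N`: the ratio of the expected degree to the maximal degree
in the `N`-th Demazure measure converges to `(m+n+2)/(3(m+n+1))`, for both sequences. -/
theorem stmt_18 (m n : ℕ) (hmn : 1 ≤ m + n) :
    Tendsto
      (fun N : ℕ =>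
        expVal (mu0 m n N) fa /
          ((((N + 1) / 2 : ℕ) : ℚ) * (m : ℚ) +
            ((m : ℚ) + (n : ℚ)) * ((((N + 1) / 2 : ℕ) : ℚ) - 1) * (((N + 1) / 2 : ℕ) : ℚ)))
      atTop (nhds (((m : ℚ) + (n : ℚ) + 2) / (3 * ((m : ℚ) + (n : ℚ) + 1)))) ∧
    Tendsto
      (fun N : ℕ =>
        expVal (mu1 m n N) fa /
          (((N / 2 : ℕ) : ℚ) * ((m : ℚ) + 2 * (n : ℚ)) +
            ((m : ℚ) + (n : ℚ)) * (((N / 2 : ℕ) : ℚ) - 1) * ((N / 2 : ℕ) : ℚ)))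
      atTop (nhds (((m : ℚ) + (n : ℚ) + 2) / (3 * ((m : ℚ) + (n : ℚ) + 1)))) := by 
  constructor
  · exact tendsto_expVal_fa_of_alternating hmn (P := fun N => N % 2 = 0)
      (h := fun N => (N + 1) / 2) (by omega) rfl (fun _ => rfl) (fun N => by split_ifs <;> omega)
      (by omega) _
  · refine tendsto_expVal_fa_of_alternating hmn (P := fun N => ¬ N % 2 = 0)
      (h := fun N => N / 2) (by omega) rfl (fun N => ?_) (fun N => by split_ifs <;> omega)
      (by omega) _
    rw [mu1, ite_not]
end
end
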